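/- The number of deque-sortable permutations of length n, for n = 1, …, 8, is 1, 2, 6, 24, 116, 634, 3762, 23638 respectively. -/

import Mathlib

/-- State of a deque switchyard: output so far, the deque, remaining input. -/
structure DState where
  output : List ℕ
  deque : List ℕ
  input : List ℕ

/-- One step of deque sorting: push the next input element to either end of the
deque, or pop either end element of the deque to the output. -/
inductive DequeStep : DState → DState → Prop
  | pushLeft (o d i : List ℕ) (x : ℕ) : DequeStep ⟨o, d, x :: i⟩ ⟨o, x :: d, i⟩
  | pushRight (o d i : List ℕ) (x : ℕ) : DequeStep ⟨o, d, x :: i⟩ ⟨o, d ++ [x], i⟩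
  | popLeft (o d i : List ℕ) (x : ℕ) : DequeStep ⟨o, x :: d, i⟩ ⟨o ++ [x], d, i⟩
  | popRight (o d i : List ℕ) (x : ℕ) : DequeStep ⟨o, d ++ [x], i⟩ ⟨o ++ [x], d, i⟩

/-- A permutation (as a list) is deque-sortable if some run outputs `1, 2, …, n`. -/
def DequeSortable (l : List ℕ) : Prop :=
  Relation.ReflTransGen DequeStep ⟨[], [], l⟩ ⟨List.range' 1 l.length, [], []⟩

/-- The number of deque-sortable permutations of length `n`. -/
noncomputable def dequeCount (n : ℕ) : ℕ :=
  Nat.card {l : List ℕ // l.Perm (List.range' 1 n) ∧ DequeSortable l}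


/-- Backwards generation of the input. -/
inductive Acc' : ℕ → List ℕ → List ℕ → Prop
  | nil : Acc' 0 [] []
  | unpopL (k : ℕ) (d w : List ℕ) : Acc' k ((k+1) :: d) w → Acc' (k+1) d w
  | unpopR (k : ℕ) (d w : List ℕ) : Acc' k (d ++ [k+1]) w → Acc' (k+1) d w
  | remL (k : ℕ) (d w : List ℕ) (x : ℕ) : Acc' k d w → Acc' k (x :: d) (x :: w)
  | remR (k : ℕ) (d w : List ℕ) (x : ℕ) : Acc' k d w → Acc' k (d ++ [x]) (x :: w)

theorem range'_one_succ (k : ℕ) : List.range' 1 (k+1) = List.range' 1 k ++ [k+1] := by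
  rw [List.range'_1_concat, Nat.add_comm 1 k]

theorem acc_of_run {l : List ℕ} {s : DState}
    (h : Relation.ReflTransGen DequeStep ⟨[], [], l⟩ s) :
    ∀ k, s.output = List.range' 1 k → ∃ p, l = p ++ s.input ∧ Acc' k s.deque p.reverse := by
  have key : ∀ (o : List ℕ) (x k : ℕ), o ++ [x] = List.range' 1 k →
      ∃ k', k = k' + 1 ∧ x = k' + 1 ∧ o = List.range' 1 k' := by
    intro o x k hk
    cases k with
    | zero => simp at hk
    | succ k =>
      rw [range'_one_succ] at hk
      have := List.append_inj' hk rfl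
      refine ⟨k, rfl, ?_, this.1⟩
      simpa using this.2
  induction h with
  | refl =>
    intro k hk
    have : k = 0 := by
      have := congrArg List.length hk
      simpa using this.symm
    subst this
    exact ⟨[], by simp, by simpa using Acc'.nil⟩
  | tail _ hs ih =>
    intro k hk
    cases hs with
    | pushLeft o d i x =>
      obtain ⟨p, hp, ha⟩ := ih k hk
      refine ⟨p ++ [x], by simpa using hp, ?_⟩
      simpa using Acc'.remL _ _ _ x ha
    | pushRight o d i x =>
      obtain ⟨p, hp, ha⟩ := ih k hk
      refine ⟨p ++ [x], by simpa using hp, ?_⟩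
      simpa using Acc'.remR _ _ _ x ha
    | popLeft o d i x =>
      obtain ⟨k', rfl, rfl, ho⟩ := key _ _ _ hk
      obtain ⟨p, hp, ha⟩ := ih k' ho
      exact ⟨p, hp, Acc'.unpopL _ _ _ ha⟩
    | popRight o d i x =>
      obtain ⟨k', rfl, rfl, ho⟩ := key _ _ _ hk
      obtain ⟨p, hp, ha⟩ := ih k' ho
      exact ⟨p, hp, Acc'.unpopR _ _ _ ha⟩

theorem run_of_acc {k : ℕ} {d w : List ℕ} (h : Acc' k d w) :
    ∀ i, Relation.ReflTransGen DequeStep ⟨[], [], w.reverse ++ i⟩ ⟨List.range' 1 k, d, i⟩ := by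
  induction h with
  | nil => intro i; exact .refl
  | unpopL k d w _ ih =>
    intro i; rw [range'_one_succ]; exact (ih i).tail (.popLeft _ _ _ _)
  | unpopR k d w _ ih =>
    intro i; rw [range'_one_succ]; exact (ih i).tail (.popRight _ _ _ _)
  | remL k d w x _ ih =>
    intro i
    have := (ih (x :: i)).tail (.pushLeft _ _ _ _)
    simpa using this
  | remR k d w x _ ih =>
    intro i
    have := (ih (x :: i)).tail (.pushRight _ _ _ _)
    simpa using this

theorem acc_perm {k : ℕ} {d w : List ℕ} (h : Acc' k d w) :
    w.Perm (List.range' 1 k ++ d) := by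
  induction h with
  | nil => simp
  | unpopL k d w _ ih => rw [range'_one_succ]; simpa using ih
  | unpopR k d w _ ih =>
    rw [range'_one_succ]
    refine ih.trans ?_
    rw [List.append_assoc]
    exact List.Perm.append_left _ List.perm_append_comm
  | remL k d w x _ ih => exact (ih.cons x).trans List.perm_middle.symm
  | remR k d w x _ ih =>
    refine (ih.cons x).trans ?_
    rw [← List.append_assoc]
    exact (List.perm_append_singleton _ _).symm

theorem sortable_iff {n : ℕ} (l : List ℕ) :
    (l.Perm (List.range' 1 n) ∧ DequeSortable l) ↔ Acc' n [] l.reverse := by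
  constructor
  · rintro ⟨hp, hs⟩
    have hl : l.length = n := by simpa using hp.length_eq
    unfold DequeSortable at hs
    rw [hl] at hs
    obtain ⟨p, hp, ha⟩ := acc_of_run hs n rfl
    simp only [List.append_nil] at hp
    rw [hp]; exact ha
  · intro h
    have hp : l.Perm (List.range' 1 n) := by
      have := acc_perm h
      simp only [List.append_nil] at this
      exact (List.reverse_perm l).symm.trans this
    refine ⟨hp, ?_⟩
    have hl : l.length = n := by simpa using hp.length_eq
    have := run_of_acc h []
    unfold DequeSortable
    rw [hl]; simpa using this

/-- Remove `x` from the right end. -/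
def remLast (x : ℕ) : List ℕ → Option (List ℕ)
  | [] => none
  | [y] => bif Nat.beq y x then some [] else none
  | y :: z :: t => (remLast x (z :: t)).map (y :: ·)

theorem remLast_eq (x : ℕ) (d d' : List ℕ) : remLast x d = some d' ↔ d = d' ++ [x] := by
  induction d generalizing d' with
  | nil => simp [remLast]
  | cons y t ih =>
    cases t with
    | nil =>
      by_cases h : y = x
      · subst h; cases d' <;> simp [remLast]
      · have : Nat.beq y x = false := by
          rw [← Bool.not_eq_true]; exact fun hb => h (Nat.eq_of_beq_eq_true hb)
        cases d' <;> simp [remLast, this, h]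
    | cons z t =>
      simp only [remLast, Option.map_eq_some_iff, ih]
      cases d' with
      | nil => simp
      | cons a d' => 
        simp only [List.cons_append, List.cons.injEq]
        constructor
        · rintro ⟨a', h, rfl, rfl⟩; exact ⟨rfl, h⟩
        · rintro ⟨rfl, h⟩; exact ⟨_, h, rfl, rfl⟩

/-- Remove `x` from the left end. -/
def remFirst (x : ℕ) : List ℕ → Option (List ℕ)
  | [] => none
  | y :: t => bif Nat.beq y x then some t else none

theorem remFirst_eq (x : ℕ) (d d' : List ℕ) : remFirst x d = some d' ↔ d = x :: d' := by
  cases d with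
  | nil => simp [remFirst]
  | cons y t =>
    by_cases h : y = x
    · subst h; simp [remFirst]
    · have : Nat.beq y x = false := by
        rw [← Bool.not_eq_true]; exact fun hb => h (Nat.eq_of_beq_eq_true hb)
      simp [remFirst, this, h]

/-- Equality test. -/
def eqL : List ℕ → List ℕ → Bool
  | [], [] => true
  | x :: s, y :: t => bif Nat.beq x y then eqL s t else false
  | _, _ => false

theorem eqL_eq (s t : List ℕ) : eqL s t = true → s = t := by
  induction s generalizing t with
  | nil => cases t <;> simp [eqL]
  | cons a s ih =>
    cases t with
    | nil => simp [eqL]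
    | cons b t =>
      cases h : Nat.beq a b
      · simp [eqL, h]
      · simp only [eqL, h, cond_true]
        intro h2
        rw [ih _ h2, Nat.eq_of_beq_eq_true h]

/-- Equality test. -/
def eqLL : List (List ℕ) → List (List ℕ) → Bool
  | [], [] => true
  | x :: s, y :: t => bif eqL x y then eqLL s t else false
  | _, _ => false

theorem eqLL_eq (s t : List (List ℕ)) : eqLL s t = true → s = t := by
  induction s generalizing t with
  | nil => cases t <;> simp [eqLL]
  | cons a s ih =>
    cases t with
    | nil => simp [eqLL]
    | cons b t =>
      cases h : eqL a b
      · simp [eqLL, h]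
      · simp only [eqLL, h, cond_true]
        intro h2
        rw [ih _ h2, eqL_eq _ _ h]

/-- Membership test. -/
def memL (x : List ℕ) : List (List ℕ) → Bool
  | [] => false
  | y :: t => bif eqL x y then true else memL x t

theorem memL_mem (x : List ℕ) (D) : memL x D = true → x ∈ D := by
  induction D with
  | nil => simp [memL]
  | cons y t ih =>
    cases h : eqL x y
    · simp only [memL, h, cond_false]
      intro h; exact List.mem_cons_of_mem _ (ih h)
    · intro _; rw [eqL_eq _ _ h]; simp

/-- Insertion without repetition. -/
def insL (x : List ℕ) (D : List (List ℕ)) : List (List ℕ) := bif memL x D then D else x :: D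

theorem mem_insL (x y : List ℕ) (D) : y ∈ insL x D ↔ y = x ∨ y ∈ D := by
  unfold insL
  cases h : memL x D
  · simp
  · have := memL_mem _ _ h
    simp only [cond_true]
    constructor
    · exact Or.inr
    · rintro (rfl | h) <;> assumption

/-- Insertion of an optional element. -/
def insO (x : Option (List ℕ)) (D : List (List ℕ)) : List (List ℕ) :=
  match x with
  | none => D
  | some x => insL x D

theorem mem_insO (x : Option (List ℕ)) (y : List ℕ) (D) :
    y ∈ insO x D ↔ x = some y ∨ y ∈ D := by
  cases x with
  | none => simp [insO]
  | some x => simp [insO, mem_insL, eq_comm]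

/-- All ways of removing `x`. -/
def remD (x : ℕ) : List (List ℕ) → List (List ℕ)
  | [] => []
  | d :: D => insO (remFirst x d) (insO (remLast x d) (remD x D))

theorem mem_remD (x : ℕ) (D) (y : List ℕ) :
    y ∈ remD x D ↔ ∃ d ∈ D, d = x :: y ∨ d = y ++ [x] := by
  induction D with
  | nil => simp [remD]
  | cons d D ih => simp [remD, mem_insO, ih, remFirst_eq, remLast_eq, or_assoc]

/-- All ways of adding `x`. -/
def pushD (x : ℕ) : List (List ℕ) → List (List ℕ)
  | [] => []
  | [] :: D => [x] :: pushD x D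
  | (y :: d) :: D => (x :: y :: d) :: (y :: (d ++ [x])) :: pushD x D

theorem mem_pushD (x : ℕ) (D) (y : List ℕ) :
    y ∈ pushD x D ↔ ∃ d ∈ D, y = x :: d ∨ y = d ++ [x] := by
  induction D with
  | nil => simp [pushD]
  | cons d D ih => cases d <;> simp [pushD, ih, or_assoc]

/-- Next state on generating `x`. -/
def child (x : ℕ) : ℕ → List (List ℕ) → ℕ × List (List ℕ)
  | 0, D => (0, remD x D)
  | k+1, D =>
    bif Nat.ble x (k+1) then
      bif Nat.beq x (k+1) then (k, D) else child x k (pushD (k+1) D)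
    else (k+1, remD x D)

/-- All deque entries exceed `k`. -/
def DInv (k : ℕ) (D : List (List ℕ)) : Prop := ∀ d ∈ D, ∀ y ∈ d, k < y

theorem DInv.rem {k : ℕ} {D} (h : DInv k D) (x : ℕ) : DInv k (remD x D) := by
  intro d hd y hy
  obtain ⟨e, he, rfl | rfl⟩ := (mem_remD _ _ _).1 hd
  · exact h _ he y (by simp [hy])
  · exact h _ he y (by simp [hy])

theorem DInv.push {k : ℕ} {D} (h : DInv (k+1) D) : DInv k (pushD (k+1) D) := by
  intro d hd y hy
  obtain ⟨e, he, rfl | rfl⟩ := (mem_pushD _ _ _).1 hd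
  all_goals
    have := h _ he y
    simp at hy
    grind

theorem DInv.child {k : ℕ} {D} (h : DInv k D) (x : ℕ) : DInv (child x k D).1 (child x k D).2 := by
  induction k generalizing D with
  | zero => exact h.rem x
  | succ k ih =>
    unfold _root_.child
    cases Nat.ble x (k+1)
    · exact h.rem x
    · cases Nat.beq x (k+1)
      · exact ih h.push
      · intro d hd y hy
        have := h d hd y hy
        simp only [cond_true]
        omega

theorem acc_gt {k : ℕ} {d v : List ℕ} (h : Acc' k d v) :
    ∀ x w, v = x :: w → k < x → ∃ d', (d = x :: d' ∨ d = d' ++ [x]) ∧ Acc' k d' w := by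
  induction h with
  | nil => simp
  | unpopL k d v _ ih =>
    intro x w hv hx
    obtain ⟨d', hd, ha⟩ := ih x w hv (by omega)
    rcases hd with hd | hd
    · simp at hd; omega
    · cases d' with
      | nil => simp at hd; omega
      | cons a d' =>
        simp at hd
        obtain ⟨rfl, rfl⟩ := hd
        exact ⟨d', Or.inr rfl, ha.unpopL⟩
  | unpopR k d v _ ih =>
    intro x w hv hx
    obtain ⟨d', hd, ha⟩ := ih x w hv (by omega)
    rcases hd with hd | hd
    · cases d with
      | nil => simp at hd; omega
      | cons a d =>
        simp at hd
        obtain ⟨rfl, rfl⟩ := hd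
        exact ⟨d, Or.inl rfl, ha.unpopR⟩
    · have := (List.append_inj' hd rfl).2
      simp at this; omega
  | remL k d v x h _ =>
    intro y w hv hx
    obtain ⟨rfl, rfl⟩ := List.cons.inj hv
    exact ⟨d, Or.inl rfl, h⟩
  | remR k d v x h _ =>
    intro y w hv hx
    obtain ⟨rfl, rfl⟩ := List.cons.inj hv
    exact ⟨d, Or.inr rfl, h⟩

theorem acc_le {k : ℕ} {d v : List ℕ} (h : Acc' (k+1) d v) (x : ℕ) (w : List ℕ)
    (hv : v = x :: w) (hx : x ∉ d) : Acc' k ((k+1) :: d) v ∨ Acc' k (d ++ [k+1]) v := by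
  cases h with
  | unpopL _ _ _ h => exact Or.inl h
  | unpopR _ _ _ h => exact Or.inr h
  | remL _ d v y h => simp at hv; simp [hv.1] at hx
  | remR _ d v y h => simp at hv; simp [hv.1] at hx

theorem rem_iff {x k : ℕ} (hx : k < x) (D) (w : List ℕ) :
    (∃ d ∈ D, Acc' k d (x :: w)) ↔ ∃ d ∈ remD x D, Acc' k d w := by
  constructor
  · rintro ⟨d, hd, h⟩
    obtain ⟨d', hd', ha⟩ := acc_gt h x w rfl hx
    exact ⟨d', (mem_remD _ _ _).2 ⟨d, hd, hd'⟩, ha⟩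
  · rintro ⟨d, hd, h⟩
    obtain ⟨e, he, rfl | rfl⟩ := (mem_remD _ _ _).1 hd
    · exact ⟨_, he, h.remL _ _ _ _⟩
    · exact ⟨_, he, h.remR _ _ _ _⟩

theorem child_iff {x k : ℕ} (hx : 0 < x) (D) (hI : DInv k D) (w : List ℕ) :
    (∃ d ∈ D, Acc' k d (x :: w)) ↔ ∃ d ∈ (child x k D).2, Acc' (child x k D).1 d w := by
  induction k generalizing D with
  | zero => exact rem_iff hx D w
  | succ k ih =>
    unfold child
    cases h : Nat.ble x (k+1)
    · refine rem_iff ?_ D w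
      by_contra hc
      rw [Nat.ble_eq_true_of_le (by omega)] at h
      cases h
    · have hle := Nat.le_of_ble_eq_true h
      have hstep : (∃ d ∈ D, Acc' (k+1) d (x :: w)) ↔
          ∃ d ∈ pushD (k+1) D, Acc' k d (x :: w) := ?_
      · rw [cond_true, hstep]
        cases hb : Nat.beq x (k+1)
        · exact ih _ hI.push
        · have hb := Nat.eq_of_beq_eq_true hb
          subst hb
          rw [rem_iff (by omega)]
          have : ∀ d, d ∈ remD (k+1) (pushD (k+1) D) ↔ d ∈ D := by
            intro d
            rw [mem_remD]
            constructor
            · rintro ⟨e, he, h⟩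
              obtain ⟨f, hf, h'⟩ := (mem_pushD _ _ _).1 he
              have hn : k+1 ∉ f := fun hm => by have := hI f hf _ hm; omega
              rcases h with rfl | rfl <;> rcases h' with h' | h'
              · simp at h'; rwa [h']
              · cases f with
                | nil => simp at h'; rwa [h']
                | cons a f => simp at h'; simp [h'.1] at hn
              · cases d with
                | nil => simp at h'; rwa [← h']
                | cons a d => simp at h'; simp [← h'.2] at hn
              · have := (List.append_inj' h' rfl).1
                rwa [this]
            · intro hd
              exact ⟨_, (mem_pushD _ _ _).2 ⟨d, hd, Or.inl rfl⟩, Or.inl rfl⟩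
          simp only [this, cond_true]
      constructor
      · rintro ⟨d, hd, ha⟩
        rcases acc_le ha x w rfl (fun hm => by have := hI d hd x hm; omega) with h | h
        · exact ⟨_, (mem_pushD _ _ _).2 ⟨d, hd, Or.inl rfl⟩, h⟩
        · exact ⟨_, (mem_pushD _ _ _).2 ⟨d, hd, Or.inr rfl⟩, h⟩
      · rintro ⟨d, hd, ha⟩
        obtain ⟨e, he, rfl | rfl⟩ := (mem_pushD _ _ _).1 hd
        · exact ⟨e, he, ha.unpopL⟩
        · exact ⟨e, he, ha.unpopR⟩

/-- Base count. -/
def base (s : ℕ × List (List ℕ)) : Bool := bif Nat.beq s.1 0 then memL [] s.2 else false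

/-- All accepted words. -/
def wordsD (n : ℕ) : ℕ → ℕ × List (List ℕ) → List (List ℕ)
  | 0, s => if s.1 = 0 ∧ [] ∈ s.2 then [[]] else []
  | m+1, s => (List.range' 1 n).flatMap fun x => (wordsD n m (child x s.1 s.2)).map (x :: ·)

theorem mem_wordsD (n m : ℕ) (s : ℕ × List (List ℕ)) (hI : DInv s.1 s.2) (w : List ℕ) :
    w ∈ wordsD n m s ↔ w.length = m ∧ (∀ x ∈ w, 1 ≤ x ∧ x ≤ n) ∧ ∃ d ∈ s.2, Acc' s.1 d w := by
  induction m generalizing s w with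
  | zero =>
    simp only [wordsD, List.length_eq_zero_iff]
    constructor
    · intro h
      split_ifs at h with hc
      · simp at h; subst h
        refine ⟨rfl, by simp, [], hc.2, ?_⟩
        rw [hc.1]; exact Acc'.nil
      · simp at h
    · rintro ⟨rfl, -, d, hd, ha⟩
      have := (acc_perm ha).length_eq
      rw [List.length_append, List.length_range', List.length_nil] at this
      have h1 : s.1 = 0 := by omega
      have h2 : d = [] := List.length_eq_zero_iff.1 (by omega)
      subst h2
      rw [if_pos ⟨h1, hd⟩]; simp
  | succ m ih =>
    simp only [wordsD, List.mem_flatMap, List.mem_map, List.mem_range'_1]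
    constructor
    · rintro ⟨x, hx, v, hv, rfl⟩
      rw [ih _ (hI.child x)] at hv
      refine ⟨by simp [hv.1], ?_, (child_iff (by omega) _ hI _).2 hv.2.2⟩
      intro y hy
      rcases List.mem_cons.1 hy with rfl | hy
      · omega
      · exact hv.2.1 y hy
    · rintro ⟨hl, hr, ha⟩
      cases w with
      | nil => simp at hl
      | cons x v =>
        have hx := hr x (by simp)
        refine ⟨x, by omega, v, ?_, rfl⟩
        rw [ih _ (hI.child x)]
        refine ⟨by simpa using hl, fun y hy => hr y (by simp [hy]), ?_⟩
        exact (child_iff (by omega) _ hI _).1 ha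

theorem nodup_wordsD (n m : ℕ) (s) : (wordsD n m s).Nodup := by
  induction m generalizing s with
  | zero => unfold wordsD; split_ifs <;> simp
  | succ m ih =>
    unfold wordsD
    rw [List.nodup_flatMap]
    refine ⟨fun x _ => (ih _).map (fun a b h => by simpa using h), ?_⟩
    refine List.Pairwise.imp ?_ (List.nodup_range' (s := 1) (n := n) (step := 1))
    intro a b hab v hv hw
    simp at hv hw
    obtain ⟨_, _, rfl⟩ := hv
    obtain ⟨_, _, h⟩ := hw
    simp at h
    exact hab h.1.symm

theorem dequeCount_eq (n : ℕ) : dequeCount n = (wordsD n n (n, [[]])).length := by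
  have hI : DInv n [[]] := by intro d hd; simp at hd; simp [hd]
  have hmem : ∀ l : List ℕ, (l.Perm (List.range' 1 n) ∧ DequeSortable l) ↔
      l ∈ ((wordsD n n (n, [[]])).map List.reverse).toFinset := by
    intro l
    rw [sortable_iff, List.mem_toFinset, List.mem_map]
    have : (∃ a ∈ wordsD n n (n, [[]]), a.reverse = l) ↔ l.reverse ∈ wordsD n n (n, [[]]) := by
      constructor
      · rintro ⟨a, ha, rfl⟩; simpa using ha
      · intro h; exact ⟨_, h, by simp⟩
    rw [this, mem_wordsD _ _ _ hI]
    constructor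
    · intro h
      have hp := acc_perm h
      refine ⟨by simpa using hp.length_eq, ?_, [], by simp, h⟩
      intro x hx
      have := hp.mem_iff.1 hx
      simp at this
      omega
    · rintro ⟨_, _, d, hd, h⟩
      simp at hd; subst hd; exact h
  unfold dequeCount
  rw [Nat.card_congr (Equiv.subtypeEquivRight hmem), Nat.card_eq_fintype_card,
    Fintype.card_coe, List.toFinset_card_of_nodup, List.length_map]
  exact (nodup_wordsD _ _ _).map List.reverse_injective

/-- Evaluate a number before continuing. -/
def forceN {α : Type} (n : ℕ) (f : ℕ → α) : α :=
  match n with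
  | 0 => f 0
  | k+1 => f (k+1)

theorem forceN_eq {α : Type} (n : ℕ) (f : ℕ → α) : forceN n f = f n := by
  cases n <;> rfl

/-- Evaluate a list before continuing. -/
def forceL {α : Type} : List ℕ → (List ℕ → α) → α
  | [], f => f []
  | a :: t, f => forceN a fun a => forceL t fun t => f (a :: t)

theorem forceL_eq {α : Type} (n : List ℕ) (f : List ℕ → α) : forceL n f = f n := by
  induction n generalizing f with
  | nil => rfl
  | cons a t ih => rw [forceL, forceN_eq, ih]

/-- Evaluate a list of lists before continuing. -/
def forceLL {α : Type} : List (List ℕ) → (List (List ℕ) → α) → α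
  | [], f => f []
  | a :: t, f => forceL a fun a => forceLL t fun t => f (a :: t)

theorem forceLL_eq {α : Type} (n : List (List ℕ)) (f : List (List ℕ) → α) :
    forceLL n f = f n := by
  induction n generalizing f with
  | nil => rfl
  | cons a t ih => rw [forceLL, forceL_eq, ih]

/-- A number identifying a deque. -/
def encL : List ℕ → ℕ → ℕ
  | [], a => a * 16
  | x :: t, a => forceN (a * 16 + x) fun a => encL t a

/-- A number identifying a family. -/
def encLL : List (List ℕ) → ℕ → ℕ
  | [], a => a
  | x :: t, a => forceN (encL x a) fun a => encLL t a

/-- Search trees of weighted states. -/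
inductive WTree : Type
  | leaf : WTree
  | node (l : WTree) (key c k : ℕ) (D : List (List ℕ)) (r : WTree) : WTree

/-- Weighted insertion of a state. -/
def insW (key c k : ℕ) (D : List (List ℕ)) : WTree → WTree
  | .leaf => .node .leaf key c k D .leaf
  | .node l key' c' k' D' r =>
    bif Nat.ble key key' then
      bif (bif Nat.beq key key' then (bif Nat.beq k k' then eqLL D D' else false) else false)
      then forceN (c + c') fun c => .node l key' c k' D' r
      else .node (insW key c k D l) key' c' k' D' r
    else .node l key' c' k' D' (insW key c k D r)

/-- Weighted total. -/
def totalW (n m : ℕ) : WTree → ℕ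
  | .leaf => 0
  | .node l _ c k D r => totalW n m l + c * (wordsD n m (k, D)).length + totalW n m r

theorem totalW_insW (n m key c k : ℕ) (D) (T) :
    totalW n m (insW key c k D T) = c * (wordsD n m (k, D)).length + totalW n m T := by
  induction T with
  | leaf => simp [insW, totalW]
  | node l key' c' k' D' r ihl ihr =>
    unfold insW
    cases Nat.ble key key'
    · simp only [cond_false, totalW, ihr]; ring
    · simp only [cond_true]
      cases h : (bif Nat.beq key key' then
        (bif Nat.beq k k' then eqLL D D' else false) else false)
      · simp only [cond_false, totalW, ihl]; ring
      · have : k = k' ∧ D = D' := by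
          cases h0 : Nat.beq key key'
          · simp [h0] at h
          · cases h1 : Nat.beq k k'
            · simp [h1] at h
            · rw [h0, h1, cond_true, cond_true] at h
              exact ⟨Nat.eq_of_beq_eq_true h1, eqLL_eq _ _ h⟩
        obtain ⟨rfl, rfl⟩ := this
        simp only [cond_true, forceN_eq, totalW]
        ring

/-- Insert only nonempty states. -/
def insN (c : ℕ) (s : ℕ × List (List ℕ)) (T : WTree) : WTree :=
  match s with
  | (_, []) => T
  | (k, d :: D) => forceN k fun k => forceLL (d :: D) fun D =>
      forceN (encLL D (k + 1)) fun key => insW key c k D T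

theorem totalW_insN (n m c : ℕ) (s) (T) :
    totalW n m (insN c s T) = c * (wordsD n m s).length + totalW n m T := by
  unfold insN
  split
  · next k =>
    have : wordsD n m (k, []) = [] := by
      rw [List.eq_nil_iff_forall_not_mem]
      intro w hw
      rw [mem_wordsD _ _ _ (by intro d hd; simp at hd)] at hw
      simp at hw
    rw [this]; simp
  · rw [forceN_eq, forceLL_eq, forceN_eq]; exact totalW_insW _ _ _ _ _ _ _

/-- Insert all children. -/
def insC (c k : ℕ) (D : List (List ℕ)) (T : WTree) : List ℕ → WTree
  | [] => T
  | x :: xs => insN c (child x k D) (insC c k D T xs)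

theorem totalW_insC (n m c k : ℕ) (D) (T) (xs : List ℕ) :
    totalW n m (insC c k D T xs) =
      c * (xs.flatMap fun x => (wordsD n m (child x k D)).map (x :: ·)).length
        + totalW n m T := by
  induction xs with
  | nil => simp [insC]
  | cons x xs ih =>
    rw [insC, totalW_insN, ih, List.flatMap_cons, List.length_append, List.length_map]
    ring

/-- One level, with accumulator. -/
def expandW (xs : List ℕ) : WTree → WTree → WTree
  | .leaf, A => A
  | .node l _ c k D r, A => expandW xs l (insC c k D (expandW xs r A) xs)

theorem totalW_expandW (n m : ℕ) (T A) :
    totalW n m (expandW (List.range' 1 n) T A) = totalW n (m+1) T + totalW n m A := by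
  induction T generalizing A with
  | leaf => simp [expandW, totalW]
  | node l key c k D r ihl ihr =>
    rw [expandW, ihl, totalW_insC, ihr]
    simp only [totalW, wordsD]
    ring

/-- Run all levels. -/
def runW (xs : List ℕ) : ℕ → WTree → WTree
  | 0, T => T
  | m+1, T => runW xs m (expandW xs T .leaf)

theorem totalW_runW (n m : ℕ) (T) :
    totalW n 0 (runW (List.range' 1 n) m T) = totalW n m T := by
  induction m generalizing T with
  | zero => rfl
  | succ m ih => rw [runW, ih, totalW_expandW]; simp [totalW]

/-- Check that the final tree is a single accepting node of the given weight. -/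
def checkW (v : ℕ) : WTree → Bool
  | .node .leaf _ c 0 [[]] .leaf => Nat.beq c v
  | _ => false

theorem checkW_eq (n v : ℕ) (T) (h : checkW v T = true) : totalW n 0 T = v := by
  unfold checkW at h
  split at h
  · simp [totalW, wordsD, Nat.eq_of_beq_eq_true h]
  · cases h

theorem dequeCount_of_run (n v : ℕ)
    (h : checkW v (runW (List.range' 1 n) n (.node .leaf 0 1 n [[]] .leaf)) = true) :
    dequeCount n = v := by
  have h1 := totalW_runW n n (.node .leaf 0 1 n [[]] .leaf)
  rw [checkW_eq n v _ h] at h1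
  rw [dequeCount_eq]
  simpa [totalW] using h1.symm

/-- The numbers of deque-sortable permutations of lengths 1 through 8. -/
theorem dequeCount_values :
    dequeCount 1 = 1 ∧ dequeCount 2 = 2 ∧ dequeCount 3 = 6 ∧ dequeCount 4 = 24 ∧
    dequeCount 5 = 116 ∧ dequeCount 6 = 634 ∧ dequeCount 7 = 3762 ∧
    dequeCount 8 = 23638 := by
  refine ⟨?_, ?_, ?_, ?_, ?_, ?_, ?_, ?_⟩
  all_goals
    apply dequeCount_of_run
    decide +kernel
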